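/- In the graded polynomial ring R = 𝔽₂[W₁, W₂, W₃, …] with deg W_i = i, write W^{(N)} = 1 + Σ_{i=1}^{N} W_i. Then the weight-9 homogeneous component of W^{(9)}·(W̄₁ + W̄₂)·(W̄₀ + W̄₁) + W^{(9)}·(C(2,0)·W̄₁ + C(2,1)·W̄₂ + C(2,2)·W̄₃) equals W₇·W₂ + W₆·(W₃ + W₁·W₂), where C(2,j) denotes the binomial coefficient reduced mod 2 (so C(2,1)·W̄₂ = 0 in R). -/

import Mathlib

open MvPolynomial Finset

/-- The variable `W_i` (for `i` a positive integer) in the graded polynomial ring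
`𝔽₂[W₁, W₂, W₃, …]`. -/
noncomputable def Wv (i : ℕ+) : MvPolynomial ℕ+ (ZMod 2) := X i

/-- The weight of a variable: `W_i` has weight `i`. -/
def wWt : ℕ+ → ℕ := fun i => (i : ℕ)

/-- The dual classes `W̄_j`, defined by `W̄₀ = 1` and
`W̄_j = Σ_{i=1}^{j} W_i · W̄_{j-i}` for `j ≥ 1`. -/
noncomputable def Wbar : ℕ → MvPolynomial ℕ+ (ZMod 2)
  | 0 => 1
  | j + 1 => ∑ i ∈ Finset.range (j + 1), Wv ⟨i + 1, Nat.succ_pos i⟩ * Wbar (j - i)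
  termination_by j => j
  decreasing_by omega

/-- The truncated total class `W^{(N)} = 1 + Σ_{i=1}^{N} W_i`. -/
noncomputable def Wtot (N : ℕ) : MvPolynomial ℕ+ (ZMod 2) :=
  1 + ∑ i ∈ Finset.range N, Wv ⟨i + 1, Nat.succ_pos i⟩

theorem isWeightedHomogeneous_Wv (i : ℕ+) : IsWeightedHomogeneous wWt (Wv i) (i : ℕ) :=
  isWeightedHomogeneous_X _ _ _

/-- Multiplying a weighted homogeneous `p` by the truncated total class, the part of weight
`deg W_{k+1} + deg p` is `W_{k+1} * p`. -/
theorem weightedHomogeneousComponent_Wtot_mul {N k d n : ℕ} {p : MvPolynomial ℕ+ (ZMod 2)}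
    (hp : IsWeightedHomogeneous wWt p d) (hk : k < N) (hn : k + 1 + d = n) :
    weightedHomogeneousComponent wWt n (Wtot N * p) = Wv ⟨k + 1, Nat.succ_pos k⟩ * p := by
  subst hn
  have hW (i : ℕ) : IsWeightedHomogeneous wWt (Wv ⟨i + 1, Nat.succ_pos i⟩ * p) (i + 1 + d) :=
    (isWeightedHomogeneous_Wv _).mul hp
  rw [Wtot, add_mul, one_mul, map_add, hp.weightedHomogeneousComponent_ne _ (by omega), zero_add,
    Finset.sum_mul, map_sum, Finset.sum_eq_single_of_mem k (Finset.mem_range.2 hk)]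
  · exact (hW k).weightedHomogeneousComponent_same
  · intro i _ hik
    exact (hW i).weightedHomogeneousComponent_ne _ (by omega)

theorem Wbar_zero : Wbar 0 = 1 := by
  rw [Wbar]

theorem Wbar_one : Wbar 1 = Wv 1 := by
  rw [Wbar]
  simp [Wbar_zero]

theorem Wbar_two : Wbar 2 = Wv 1 * Wv 1 + Wv 2 := by
  rw [Wbar]
  simp [Finset.sum_range_succ, Wbar_zero, Wbar_one]

theorem Wbar_three : Wbar 3 = Wv 1 * (Wv 1 * Wv 1 + Wv 2) + Wv 2 * Wv 1 + Wv 3 := by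
  rw [Wbar]
  simp [Finset.sum_range_succ, Wbar_zero, Wbar_one, Wbar_two]

/-- the weight-9 homogeneous component of
`W⁽⁹⁾·(W̄₁ + W̄₂)·(W̄₀ + W̄₁) + W⁽⁹⁾·(C(2,0)·W̄₁ + C(2,1)·W̄₂ + C(2,2)·W̄₃)`
equals `W₇·W₂ + W₆·(W₃ + W₁·W₂)`, where the binomial coefficients are reduced mod 2. -/
theorem statement10 :
    weightedHomogeneousComponent wWt 9
      (Wtot 9 * (Wbar 1 + Wbar 2) * (Wbar 0 + Wbar 1) +
        Wtot 9 * ((Nat.choose 2 0 : MvPolynomial ℕ+ (ZMod 2)) * Wbar 1 +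
          (Nat.choose 2 1 : MvPolynomial ℕ+ (ZMod 2)) * Wbar 2 +
          (Nat.choose 2 2 : MvPolynomial ℕ+ (ZMod 2)) * Wbar 3)) =
      Wv 7 * Wv 2 + Wv 6 * (Wv 3 + Wv 1 * Wv 2) := by
  have h2 : (2 : MvPolynomial ℕ+ (ZMod 2)) = 0 := CharTwo.two_eq_zero
  have key : Wtot 9 * (Wbar 1 + Wbar 2) * (Wbar 0 + Wbar 1) +
        Wtot 9 * ((Nat.choose 2 0 : MvPolynomial ℕ+ (ZMod 2)) * Wbar 1 +
          (Nat.choose 2 1 : MvPolynomial ℕ+ (ZMod 2)) * Wbar 2 +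
          (Nat.choose 2 2 : MvPolynomial ℕ+ (ZMod 2)) * Wbar 3) =
      Wtot 9 * Wv 2 + Wtot 9 * (Wv 3 + Wv 1 * Wv 2) := by
    simp only [Nat.choose_zero_right, Nat.choose_one_right, Nat.choose_self, Nat.cast_one,
      Nat.cast_ofNat, Wbar_zero, Wbar_one, Wbar_two, Wbar_three]
    linear_combination (Wtot 9 * (Wv 1 + 2 * Wv 1 ^ 2 + Wv 1 ^ 3 + Wv 2 + Wv 1 * Wv 2)) * h2
  have h3 : IsWeightedHomogeneous wWt (Wv 3 + Wv 1 * Wv 2) 3 :=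
    (isWeightedHomogeneous_Wv 3).add
      ((isWeightedHomogeneous_Wv 1).mul (isWeightedHomogeneous_Wv 2))
  rw [key, map_add,
    weightedHomogeneousComponent_Wtot_mul (k := 6) (n := 9) (isWeightedHomogeneous_Wv 2) (by norm_num) rfl,
    weightedHomogeneousComponent_Wtot_mul (k := 5) (n := 9) h3 (by norm_num) rfl]
  rfl
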